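/- Θ(A^{m−1}) = F_Ev^n; equivalently, Ω(A^{m−1}) = F_Od^n. -/

import Mathlib

open Finset Pointwise

abbrev Word (n : ℕ) := Fin n → ZMod 2

def FEv (n : ℕ) : Set (Word n) := {x | Even (hammingNorm x)}

def FOd (n : ℕ) : Set (Word n) := {x | ¬ Even (hammingNorm x)}

def nbr {n : ℕ} (S : Set (Word n)) : Set (Word n) := {y | ∃ x ∈ S, hammingDist y x = 1}

def theta {n : ℕ} (G : Set (Word n)) : Set (Word n) :=
  {x | Even (hammingNorm x) ∧ nbr {x} ⊆ nbr G}

def ExtPerfect {n : ℕ} (C : Set (Word n)) : Prop :=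
  C ⊆ FEv n ∧ (∀ x ∈ C, ∀ y ∈ C, x ≠ y → Disjoint (nbr {x}) (nbr {y})) ∧ nbr C = FOd n

def IsIsometry {n : ℕ} (g : Word n → Word n) : Prop :=
  Function.Bijective g ∧ ∀ x y, hammingDist (g x) (g y) = hammingDist x y

def embWord (m t : ℕ) (v : Word (2 ^ (m - t))) : Word (2 ^ m) := fun i =>
  if h : (i : ℕ) < 2 ^ (m - t) then v ⟨i, h⟩
  else if h2 : (i : ℕ) < 2 * 2 ^ (m - t) then v ⟨(i : ℕ) - 2 ^ (m - t), by omega⟩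
  else 0

def Vt (m t : ℕ) : Set (Word (2 ^ m)) :=
  {x | ∃ v : Word (2 ^ (m - t)), Even (hammingNorm v) ∧ x = embWord m t v}

def At (m : ℕ) : ℕ → Set (Word (2 ^ m))
  | 0 => {0}
  | 1 => Vt m 1
  | t + 2 => Vt m (t + 2) + At m (t + 1)

def IsComp (m t : ℕ) (G : Set (Word (2 ^ m))) : Prop :=
  G ⊆ FEv (2 ^ m) ∧ G.ncard = (At m t).ncard ∧ nbr G = nbr (At m t)

def IsMuComp (m t : ℕ) (μ : Word (2 ^ m)) (M : Set (Word (2 ^ m))) : Prop :=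
  (∀ i : Fin (2 ^ m), 2 ^ (m - t) ≤ (i : ℕ) → μ i = 0) ∧
  ∃ G, IsComp m t G ∧ M = (fun x => μ + x) '' G

def arrEntry (m t : ℕ) (x : Word (2 ^ m)) (i : Fin (2 ^ t)) (j : Fin (2 ^ (m - t))) : ZMod 2 :=
  x ⟨((i : ℕ) * 2 ^ (m - t) + (j : ℕ)) % 2 ^ m, Nat.mod_lt _ (Nat.two_pow_pos m)⟩

def pchk (m t : ℕ) (x : Word (2 ^ m)) : Word (2 ^ (m - t)) :=
  fun j => ∑ i : Fin (2 ^ t), arrEntry m t x i j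

def Bt (m : ℕ) : ℕ → Set (Word (2 ^ m))
  | 0 => Vt m 1
  | 1 => Vt m 1
  | t + 2 => Vt m (t + 2) + theta (At m (t + 1))

lemma natCast_hammingNorm {n : ℕ} (x : Word n) : (hammingNorm x : ZMod 2) = ∑ i, x i := by
  have h : ∀ a : ZMod 2, (if a ≠ 0 then 1 else 0 : ZMod 2) = a := by decide
  rw [hammingNorm, Finset.card_filter]
  push_cast
  exact Finset.sum_congr rfl fun i _ => h (x i)

lemma even_hammingNorm_iff {n : ℕ} (x : Word n) : Even (hammingNorm x) ↔ ∑ i, x i = 0 := by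
  rw [← natCast_hammingNorm, ZMod.natCast_eq_zero_iff_even]

lemma even_hammingNorm_add {n : ℕ} {x y : Word n} (hx : Even (hammingNorm x))
    (hy : Even (hammingNorm y)) : Even (hammingNorm (x + y)) := by
  rw [even_hammingNorm_iff] at *
  simp [Finset.sum_add_distrib, hx, hy]

lemma nbr_subset_FOd {n : ℕ} {S : Set (Word n)} (hS : S ⊆ FEv n) : nbr S ⊆ FOd n := by
  rintro y ⟨x, hx, hd⟩ hy
  rw [hammingDist_eq_hammingNorm] at hd
  have h := natCast_hammingNorm (-y + x)
  rw [hd] at h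
  have hx' := (even_hammingNorm_iff x).1 (hS hx)
  rw [even_hammingNorm_iff] at hy
  simp [Finset.sum_add_distrib, hx', hy] at h

lemma hammingDist_add_single {n : ℕ} (x : Word n) (i : Fin n) :
    hammingDist x (x + Pi.single i 1) = 1 := by
  rw [hammingDist, Finset.card_eq_one]
  refine ⟨i, ?_⟩
  ext j
  by_cases h : j = i <;> simp [h]

lemma even_hammingNorm_embWord {m t : ℕ} (ht : 2 * 2 ^ (m - t) ≤ 2 ^ m)
    (v : Word (2 ^ (m - t))) : Even (hammingNorm (embWord m t v)) := by
  rw [even_hammingNorm_iff]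
  obtain ⟨r, hr⟩ := Nat.exists_eq_add_of_le ht
  set g : ℕ → ZMod 2 := fun i =>
    if h : i < 2 ^ (m - t) then v ⟨i, h⟩
    else if h2 : i < 2 * 2 ^ (m - t) then v ⟨i - 2 ^ (m - t), by omega⟩
    else 0 with hg
  have h0 : ∑ i, embWord m t v i = ∑ i ∈ Finset.range (2 ^ m), g i := by
    rw [Finset.sum_range]
    rfl
  have h1 : ∑ i ∈ Finset.range r, g (2 * 2 ^ (m - t) + i) = 0 := by
    refine Finset.sum_eq_zero fun i _ => ?_
    simp only [hg]
    rw [dif_neg (by omega), dif_neg (by omega)]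
  have h2 : ∑ i ∈ Finset.range (2 ^ (m - t)), g (2 ^ (m - t) + i)
      = ∑ i ∈ Finset.range (2 ^ (m - t)), g i := by
    refine Finset.sum_congr rfl fun i hi => ?_
    rw [Finset.mem_range] at hi
    simp only [hg]
    rw [dif_neg (by omega), dif_pos (by omega), dif_pos hi]
    congr 2
    omega
  rw [h0, hr, Finset.sum_range_add, h1, add_zero, two_mul, Finset.sum_range_add, h2]
  exact CharTwo.add_self_eq_zero _

lemma At_succ (m t : ℕ) : At m (t + 1) = Vt m (t + 1) + At m t := by
  cases t with
  | zero => simp [At]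
  | succ t => rfl

lemma At_subset_FEv {m t : ℕ} (ht : t ≤ m) : At m t ⊆ FEv (2 ^ m) := by
  induction t with
  | zero =>
    rintro x rfl
    simp [FEv]
  | succ t ih =>
    rw [At_succ]
    rintro _ ⟨_, ⟨v, -, rfl⟩, q, hq, rfl⟩
    refine even_hammingNorm_add (even_hammingNorm_embWord ?_ v) (ih (by omega) hq)
    rw [← pow_succ']
    exact Nat.pow_le_pow_right two_pos (by omega)

/-- Extension of a word by zeros to twice its length. -/
def zeroExtend (m : ℕ) (w : Word (2 ^ m)) : Word (2 ^ (m + 1)) := fun i =>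
  if h : (i : ℕ) < 2 ^ m then w ⟨i, h⟩ else 0

lemma zeroExtend_add (m : ℕ) (p q : Word (2 ^ m)) :
    zeroExtend m (p + q) = zeroExtend m p + zeroExtend m q := by
  ext i
  by_cases h : (i : ℕ) < 2 ^ m <;> simp [zeroExtend, h]

lemma mem_Vt_of_eq {m t k : ℕ} (hk : k = m - t) (v : Word (2 ^ k)) (hv : Even (hammingNorm v))
    (x : Word (2 ^ m))
    (hx : ∀ i : Fin (2 ^ m), x i = if h : (i : ℕ) < 2 ^ k then v ⟨i, h⟩
      else if h2 : (i : ℕ) < 2 * 2 ^ k then v ⟨(i : ℕ) - 2 ^ k, by omega⟩ else 0) :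
    x ∈ Vt m t := by
  subst hk
  exact ⟨v, hv, funext hx⟩

lemma zeroExtend_mem_Vt {m t : ℕ} (ht : t + 1 ≤ m) {p : Word (2 ^ m)} (hp : p ∈ Vt m (t + 1)) :
    zeroExtend m p ∈ Vt (m + 1) (t + 2) := by
  obtain ⟨v, hv, rfl⟩ := hp
  refine mem_Vt_of_eq (by omega) v hv _ fun i => ?_
  have h : 2 * 2 ^ (m - (t + 1)) ≤ 2 ^ m := by
    rw [← pow_succ']
    exact Nat.pow_le_pow_right two_pos (by omega)
  by_cases hi : (i : ℕ) < 2 ^ m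
  · simp [zeroExtend, embWord, hi]
  · rw [zeroExtend, dif_neg hi, dif_neg (by omega), dif_neg (by omega)]

lemma add_zeroExtend_mem_At {m t : ℕ} (ht : t ≤ m) {y : Word (2 ^ (m + 1))}
    (hy : y ∈ Vt (m + 1) 1) {w : Word (2 ^ m)} (hw : w ∈ At m t) :
    y + zeroExtend m w ∈ At (m + 1) (t + 1) := by
  induction t generalizing w with
  | zero =>
    obtain rfl : w = 0 := hw
    have h : zeroExtend m 0 = 0 := by
      ext i
      simp [zeroExtend]
    rwa [h, add_zero]
  | succ t ih =>
    rw [At_succ] at hw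
    obtain ⟨p, hp, q, hq, rfl⟩ := hw
    rw [At_succ]
    refine ⟨_, zeroExtend_mem_Vt ht hp, _, ih (by omega) hq, ?_⟩
    simp only [zeroExtend_add]
    abel

lemma sum_two_pow_succ {m : ℕ} (x : Word (2 ^ (m + 1))) :
    ∑ i, x i = ∑ j : Fin (2 ^ m), x ⟨j, by have := j.2; rw [pow_succ]; omega⟩
      + ∑ j : Fin (2 ^ m), x ⟨2 ^ m + j, by have := j.2; rw [pow_succ]; omega⟩ := by
  have h : 2 ^ m + 2 ^ m = 2 ^ (m + 1) := by rw [pow_succ]; omega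
  rw [← (finCongr h).sum_comp, Fin.sum_univ_add]
  rfl

lemma embWord_one_of_lt {m : ℕ} (v : Word (2 ^ m)) {i : Fin (2 ^ (m + 1))}
    (h : (i : ℕ) < 2 ^ m) : embWord (m + 1) 1 v i = v ⟨i, h⟩ :=
  dif_pos h

lemma embWord_one_of_not_lt {m : ℕ} (v : Word (2 ^ m)) {i : Fin (2 ^ (m + 1))}
    (h : ¬ (i : ℕ) < 2 ^ m) :
    embWord (m + 1) 1 v i = v ⟨i - 2 ^ m, by have := i.2.trans_eq (pow_succ 2 m); omega⟩ :=
  (dif_neg h).trans (dif_pos (i.2.trans_eq (pow_succ' 2 m)))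

lemma exists_add_single_mem_At (m : ℕ) (x : Word (2 ^ (m + 1))) (hx : ∑ i, x i = 1) :
    ∃ i, x + Pi.single i 1 ∈ At (m + 1) m := by
  induction m with
  | zero =>
    have h : ∀ x : Word 2, ∑ i, x i = 1 → ∃ i, x + Pi.single i 1 = 0 := by decide
    exact h x hx
  | succ m ih =>
    have hpow : 2 ^ (m + 1 + 1) = 2 ^ (m + 1) + 2 ^ (m + 1) := by rw [pow_succ]; omega
    rw [sum_two_pow_succ] at hx
    set a : Word (2 ^ (m + 1)) := fun j => x ⟨j, by have := j.2; omega⟩ with ha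
    set b : Word (2 ^ (m + 1)) := fun j => x ⟨2 ^ (m + 1) + j, by have := j.2; omega⟩ with hb
    obtain ⟨i, hi⟩ := ih (a + b) (by rw [← hx, ← Finset.sum_add_distrib]; rfl)
    have hchar : ∀ c : ZMod 2, c + c = 0 := CharTwo.add_self_eq_zero
    -- The flipped coordinate lies in the half that makes the second half even.
    by_cases hbe : ∑ j, b j = 0
    · refine ⟨⟨i, by have := i.2; omega⟩, ?_⟩
      have hy : embWord (m + 2) 1 b ∈ Vt (m + 2) 1 := ⟨b, (even_hammingNorm_iff b).2 hbe, rfl⟩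
      convert add_zeroExtend_mem_At (by omega) hy hi using 1
      ext j
      by_cases hj : (j : ℕ) < 2 ^ (m + 1)
      · rw [Pi.add_apply, Pi.add_apply, zeroExtend, dif_pos hj, embWord_one_of_lt _ hj]
        simp only [Pi.add_apply, Pi.single_apply, Fin.ext_iff, ha, hb]
        linear_combination -hchar (x ⟨2 ^ (m + 1) + j, by omega⟩)
      · have hj2 : 2 ^ (m + 1) + ((j : ℕ) - 2 ^ (m + 1)) = j := by omega
        rw [Pi.add_apply, Pi.add_apply, zeroExtend, dif_neg hj, embWord_one_of_not_lt _ hj]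
        simp only [Pi.single_apply, Fin.ext_iff, hb, hj2]
        rw [if_neg (by omega)]
    · refine ⟨⟨2 ^ (m + 1) + i, by have := i.2; omega⟩, ?_⟩
      have hbo : ∑ j, (b + Pi.single i 1 : Word (2 ^ (m + 1))) j = 0 := by
        have h : ∀ c : ZMod 2, c ≠ 0 → c + 1 = 0 := by decide
        simpa [Finset.sum_add_distrib] using h _ hbe
      have hy : embWord (m + 2) 1 (b + Pi.single i 1) ∈ Vt (m + 2) 1 :=
        ⟨_, (even_hammingNorm_iff _).2 hbo, rfl⟩
      convert add_zeroExtend_mem_At (by omega) hy hi using 1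
      ext j
      by_cases hj : (j : ℕ) < 2 ^ (m + 1)
      · rw [Pi.add_apply, Pi.add_apply, zeroExtend, dif_pos hj, embWord_one_of_lt _ hj]
        simp only [Pi.add_apply, Pi.single_apply, Fin.ext_iff, ha, hb]
        rw [if_neg (by omega)]
        linear_combination
          -hchar (x ⟨2 ^ (m + 1) + j, by omega⟩) - hchar (if (j : ℕ) = i then 1 else 0)
      · have hj2 : 2 ^ (m + 1) + ((j : ℕ) - 2 ^ (m + 1)) = j := by omega
        rw [Pi.add_apply, Pi.add_apply, zeroExtend, dif_neg hj, embWord_one_of_not_lt _ hj]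
        simp only [Pi.add_apply, Pi.single_apply, Fin.ext_iff, hb, hj2]
        simp only [add_zero,
          show (j : ℕ) = 2 ^ (m + 1) + i ↔ (j : ℕ) - 2 ^ (m + 1) = i by omega]

lemma nbr_At_eq_FOd {m : ℕ} (hm : 1 ≤ m) : nbr (At m (m - 1)) = FOd (2 ^ m) := by
  refine (nbr_subset_FOd (At_subset_FEv (by omega))).antisymm fun x hx => ?_
  obtain ⟨m, rfl⟩ := Nat.exists_eq_add_of_le' hm
  have h : ∀ c : ZMod 2, c ≠ 0 → c = 1 := by decide
  obtain ⟨i, hi⟩ := exists_add_single_mem_At m x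
    (h _ fun h0 => hx ((even_hammingNorm_iff x).2 h0))
  exact ⟨_, hi, hammingDist_add_single x i⟩

/-- Θ(A^{m-1}) = F_Ev^n; equivalently, Ω(A^{m-1}) = F_Od^n. -/
theorem stmt_8 (m : ℕ) (hm : 4 ≤ m) :
    theta (At m (m - 1)) = FEv (2 ^ m) ∧ nbr (At m (m - 1)) = FOd (2 ^ m) := by
  have h := nbr_At_eq_FOd (m := m) (by omega)
  refine ⟨Set.Subset.antisymm (fun x hx => hx.1) fun x hx => ⟨hx, ?_⟩, h⟩
  rw [h]
  exact nbr_subset_FOd (Set.singleton_subset_iff.2 hx)
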